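/- arXiv:1009.0564 — 2 statements merged into one kernel-verified Lean document; each statement's English description precedes it below -/
import Mathlib

section
/- Let I ⊂ ℝ be a nonempty open interval and 0 < a < b. Let w : I × (a,b) × (ℝ³ \ {0}) → ℂ⁶ be smooth with w(t,r,λω) = w(t,r,ω) for all λ > 0, and assume that for every fixed ω ∈ S² each component of (t,x) ↦ w(t,|x|,ω) satisfies the wave equation ∂²ₜu − Δₓu = 0 on {(t,x) : t ∈ I, a < |x| < b}. Write u(t,x) := w(t,|x|, x/|x|) = (E(t,x), B(t,x)) with E, B the first three and last three components. Then u satisfies, on {(t,x) : t ∈ I, a < |x| < b}, the equations □u = 0 (componentwise) and div E = div B = 0 if and only if there exist constant vectors c₁, c₂ ∈ ℂ⁶ such that u(t,x) = c₁ + c₂ t for all such (t,x). -/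
noncomputable section

open Real Set MeasureTheory

/-- Three dimensional Euclidean space. -/
abbrev R3 : Type := EuclideanSpace ℝ (Fin 3)

/-- The vector `(1,0,0)`. -/
def e1 : R3 := EuclideanSpace.single 0 1

/-- The cross product on `ℝ³`. -/
def cross3 (u v : R3) : R3 :=
  (WithLp.equiv 2 (Fin 3 → ℝ)).symm
    ![u 1 * v 2 - u 2 * v 1, u 2 * v 0 - u 0 * v 2, u 0 * v 1 - u 1 * v 0]

/-- Partial derivative in the `i`-th coordinate direction. -/
def pd {E : Type*} [NormedAddCommGroup E] [NormedSpace ℝ E]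
    (i : Fin 3) (f : R3 → E) (x : R3) : E :=
  fderiv ℝ f x (EuclideanSpace.single i 1)

/-- The curl of a vector field on `ℝ³`. -/
def curl3 (F : R3 → R3) (x : R3) : R3 :=
  (WithLp.equiv 2 (Fin 3 → ℝ)).symm
    ![pd 1 (fun y => F y 2) x - pd 2 (fun y => F y 1) x,
      pd 2 (fun y => F y 0) x - pd 0 (fun y => F y 2) x,
      pd 0 (fun y => F y 1) x - pd 1 (fun y => F y 0) x]

/-- The divergence of a vector field on `ℝ³`. -/
def div3 (F : R3 → R3) (x : R3) : ℝ :=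
  pd 0 (fun y => F y 0) x + pd 1 (fun y => F y 1) x + pd 2 (fun y => F y 2) x

/-- The wave operator `□u = ∂ₜ²u − Δₓu` applied to a function `u : ℝ × ℝ³ → ℂ`
(written in curried form), evaluated at `(t,x)`. -/
def waveOp (u : ℝ → R3 → ℂ) (t : ℝ) (x : R3) : ℂ :=
  deriv (fun s => deriv (fun s' => u s' x) s) t
    - (pd 0 (fun y => pd 0 (fun z => u t z) y) x
       + pd 1 (fun y => pd 1 (fun z => u t z) y) x
       + pd 2 (fun y => pd 2 (fun z => u t z) y) x)

open scoped Topology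

section CoordinateDerivatives

variable {E : Type*} [NormedAddCommGroup E] [NormedSpace ℝ E]

theorem eventuallyEq_pd {f g : R3 → E} {x : R3} (h : f =ᶠ[𝓝 x] g) (i : Fin 3) :
    pd i f =ᶠ[𝓝 x] pd i g :=
  (h.fderiv (𝕜 := ℝ)).mono fun y hy => by simp only [pd, hy]

theorem sum_coord_smul_apply_single (L : R3 →L[ℝ] E) (x : R3) :
    ∑ i, x i • L (EuclideanSpace.single i 1) = L x := by
  conv_rhs => rw [← (EuclideanSpace.basisFun (Fin 3) ℝ).sum_repr x]
  simp [map_sum]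

theorem contDiffAt_pd {f : R3 → E} {x : R3} {m n : WithTop ℕ∞} (hf : ContDiffAt ℝ n f x)
    (hmn : m + 1 ≤ n) (i : Fin 3) : ContDiffAt ℝ m (pd i f) x :=
  (hf.fderiv_right hmn).clm_apply contDiffAt_const

theorem pd_mul {f g : R3 → ℝ} {x : R3} (hf : DifferentiableAt ℝ f x)
    (hg : DifferentiableAt ℝ g x) (i : Fin 3) :
    pd i (fun y => f y * g y) x = f x * pd i g x + g x * pd i f x := by
  simp [pd, fderiv_fun_mul hf hg]

theorem pd_continuousLinearMap_comp {F : Type*} [NormedAddCommGroup F] [NormedSpace ℝ F]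
    (L : E →L[ℝ] F) {f : R3 → E} {x : R3} (hf : DifferentiableAt ℝ f x) (i : Fin 3) :
    pd i (fun y => L (f y)) x = L (pd i f x) := by
  have h := (L.hasFDerivAt.comp x hf.hasFDerivAt).fderiv
  simp only [Function.comp_def] at h
  simp [pd, h]

/-- Euler's identity for functions invariant under positive dilations. -/
theorem fderiv_apply_self_eq_zero {f : R3 → E} {x : R3} (hf : DifferentiableAt ℝ f x)
    (hom : ∀ l : ℝ, 0 < l → f (l • x) = f x) : fderiv ℝ f x x = 0 := by
  have h1 : HasDerivAt (fun l : ℝ => l • x) x 1 := by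
    simpa using (hasDerivAt_id (1 : ℝ)).smul_const x
  have hf' : HasFDerivAt f (fderiv ℝ f x) ((1 : ℝ) • x) := by simpa using hf.hasFDerivAt
  have h2 : HasDerivAt (fun l : ℝ => f (l • x)) (fderiv ℝ f x x) 1 := hf'.comp_hasDerivAt _ h1
  have h3 : HasDerivAt (fun l : ℝ => f (l • x)) 0 1 :=
    (hasDerivAt_const (1 : ℝ) (f x)).congr_of_eventuallyEq <| by
      filter_upwards [lt_mem_nhds (zero_lt_one (α := ℝ))] with l hl using hom l hl
  exact h2.unique h3

theorem pd_norm {x : R3} (hx : x ≠ 0) (i : Fin 3) :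
    pd i (fun y => ‖y‖) x = ‖x‖⁻¹ * x i := by
  have hn : DifferentiableAt ℝ (fun y : R3 => ‖y‖) x :=
    (contDiffAt_norm ℝ hx (n := 1)).differentiableAt one_ne_zero
  have h := pd_mul hn hn i
  have h2 : pd i (fun y : R3 => ‖y‖ * ‖y‖) x = 2 * x i := by
    simp only [pd, ← pow_two, fderiv_norm_sq_apply]
    simp [EuclideanSpace.inner_single_right]
  have : ‖x‖ ≠ 0 := norm_ne_zero_iff.2 hx
  field_simp
  linarith

end CoordinateDerivatives

section Harmonic

theorem integral_pd_eq_zero {F : R3 → ℝ} (hF : ContDiff ℝ 1 F) (hc : HasCompactSupport F)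
    (i : Fin 3) : ∫ x, pd i F x = 0 := by
  have hd : Differentiable ℝ F := hF.differentiable one_ne_zero
  have hFint : Integrable (fun x => fderiv ℝ F x (EuclideanSpace.single i 1)) :=
    ((hF.continuous_fderiv one_ne_zero).clm_apply continuous_const).integrable_of_hasCompactSupport
      (hc.fderiv_apply ℝ _)
  have := integral_mul_fderiv_eq_neg_fderiv_mul_of_integrable (μ := (volume : Measure R3))
    (f := fun _ => (1 : ℝ)) (g := F) (v := EuclideanSpace.single i 1) (by simp)
    (by simpa using hFint) (by simpa using hd.continuous.integrable_of_hasCompactSupport hc)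
    (by simp) (fun x _ => hd x)
  simpa [pd] using this

/-- A radial cutoff which is supported away from the origin. -/
theorem exists_radial_cutoff {x₀ : R3} (hx₀ : x₀ ≠ 0) :
    ∃ χ : ℝ → ℝ, ContDiff ℝ 2 χ ∧ (∀ s, 0 ≤ χ s) ∧ 0 < χ (‖x₀‖ ^ 2) ∧
      HasCompactSupport (fun x : R3 => χ (‖x‖ ^ 2)) ∧
      (fun x : R3 => χ (‖x‖ ^ 2)) =ᶠ[𝓝 0] 0 := by
  have hc : 0 < ‖x₀‖ ^ 2 := by positivity
  set c := ‖x₀‖ ^ 2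
  let χ : ContDiffBump c := ⟨c / 4, c / 2, by positivity, by linarith⟩
  refine ⟨χ, χ.contDiff, χ.nonneg', ?_, ?_, ?_⟩
  · exact χ.pos_of_mem_ball (Metric.mem_ball_self χ.rOut_pos)
  · refine HasCompactSupport.intro (isCompact_closedBall (0 : R3) (2 * ‖x₀‖)) fun x hx => ?_
    apply χ.zero_of_le_dist
    have hx : 2 * ‖x₀‖ < ‖x‖ := by simpa using hx
    rw [Real.dist_eq]
    refine le_trans ?_ (le_abs_self _)
    change c / 2 ≤ _
    have := norm_nonneg x₀
    simp only [c] at *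
    nlinarith
  · have : ∀ᶠ x : R3 in 𝓝 0, ‖x‖ ^ 2 < c / 2 := by
      have hcont : ContinuousAt (fun x : R3 => ‖x‖ ^ 2) 0 := by fun_prop
      exact hcont.eventually (gt_mem_nhds (by simpa using half_pos hc))
    filter_upwards [this] with x hx
    apply χ.zero_of_le_dist
    rw [Real.dist_eq, abs_sub_comm]
    refine le_trans ?_ (le_abs_self _)
    change c / 2 ≤ _
    linarith

theorem fderiv_eq_zero_of_homogeneous_of_harmonic {g : R3 → ℝ}
    (hg : ∀ x, x ≠ 0 → ContDiffAt ℝ 2 g x)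
    (hom : ∀ x, x ≠ 0 → ∀ l : ℝ, 0 < l → g (l • x) = g x)
    (harm : ∀ x, x ≠ 0 → ∑ i, pd i (pd i g) x = 0) {x₀ : R3} (hx₀ : x₀ ≠ 0) :
    fderiv ℝ g x₀ = 0 := by
  obtain ⟨χ, hχ, hχ0, hχpos, hφc, hφ0⟩ := exists_radial_cutoff hx₀
  set φ : R3 → ℝ := fun x => χ (‖x‖ ^ 2)
  have hφ : ContDiff ℝ 2 φ := hχ.comp (contDiff_norm_sq ℝ)
  let F : Fin 3 → R3 → ℝ := fun i x => φ x * (g x * pd i g x)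
  have hF0 : ∀ i, F i =ᶠ[𝓝 0] 0 := fun i => by
    filter_upwards [hφ0] with x hx
    simp [F, hx]
  have hF : ∀ i, ContDiff ℝ 1 (F i) := fun i => contDiff_iff_contDiffAt.2 fun x => by
    by_cases hx : x = 0
    · subst hx
      exact (contDiffAt_const (c := (0 : ℝ))).congr_of_eventuallyEq (hF0 i)
    · exact (hφ.contDiffAt.of_le (by norm_num)).mul (((hg x hx).of_le (by norm_num)).mul
        (contDiffAt_pd (hg x hx) (by norm_num) i))
  have hFc : ∀ i, HasCompactSupport (F i) := fun i => hφc.mul_right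
  have hdiv : ∀ x, ∑ i, pd i (F i) x = φ x * ∑ i, pd i g x ^ 2 := fun x => by
    by_cases hx : x = 0
    · subst hx
      have h1 : ∀ i, pd i (F i) 0 = 0 := fun i => by
        rw [(eventuallyEq_pd (hF0 i) i).eq_of_nhds]
        simp [pd, Pi.zero_def]
      simp [h1, show φ 0 = 0 from hφ0.eq_of_nhds]
    · have hgx := (hg x hx).differentiableAt two_ne_zero
      have hpx := fun i => (contDiffAt_pd (m := 1) (hg x hx) (by norm_num) i).differentiableAt one_ne_zero
      have hφx := hφ.contDiffAt.differentiableAt (x := x) two_ne_zero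
      have hpφ : ∀ i, pd i φ x = deriv χ (‖x‖ ^ 2) * (2 * x i) := fun i => by
        have h1 : HasFDerivAt φ (deriv χ (‖x‖ ^ 2) • (2 • innerSL ℝ x)) x :=
          ((hχ.differentiable two_ne_zero _).hasDerivAt).comp_hasFDerivAt x
            (hasStrictFDerivAt_norm_sq x).hasFDerivAt
        simp [pd, h1.fderiv, EuclideanSpace.inner_single_right]
      have hE : ∑ i, x i * pd i g x = 0 := by
        simpa [pd] using (sum_coord_smul_apply_single (fderiv ℝ g x) x).trans
          (fderiv_apply_self_eq_zero hgx (hom x hx))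
      have hL := harm x hx
      have h1 : ∀ i, pd i (F i) x = φ x * (g x * pd i (pd i g) x + pd i g x * pd i g x)
          + g x * pd i g x * (deriv χ (‖x‖ ^ 2) * (2 * x i)) := fun i => by
        rw [pd_mul hφx (hgx.fun_mul (hpx i)), pd_mul hgx (hpx i), hpφ]
      simp only [h1, Fin.sum_univ_three] at *
      linear_combination φ x * g x * hL + 2 * g x * deriv χ (‖x‖ ^ 2) * hE
  have hcont : Continuous fun x => φ x * ∑ i, pd i g x ^ 2 := by
    simp only [← hdiv]
    exact continuous_finsetSum _ fun i _ =>
      ((hF i).continuous_fderiv one_ne_zero).clm_apply continuous_const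
  have hzero : ∫ x, φ x * ∑ i, pd i g x ^ 2 = 0 := by
    simp only [← hdiv]
    rw [integral_finsetSum _ fun i _ => ?_]
    · simp [integral_pd_eq_zero (hF _) (hFc _)]
    · exact (((hF i).continuous_fderiv one_ne_zero).clm_apply
        continuous_const).integrable_of_hasCompactSupport ((hFc i).fderiv_apply ℝ _)
  have hsq : φ x₀ * ∑ i, pd i g x₀ ^ 2 = 0 := by
    by_contra hne
    exact (hcont.integral_pos_of_hasCompactSupport_nonneg_nonzero hφc.mul_right
      (fun x => mul_nonneg (hχ0 _) (Finset.sum_nonneg fun i _ => sq_nonneg _)) hne).ne' hzero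
  have hpd : ∀ i, pd i g x₀ = 0 := fun i => by
    have := (mul_eq_zero.1 hsq).resolve_left hχpos.ne'
    rw [Finset.sum_eq_zero_iff_of_nonneg fun i _ => sq_nonneg _] at this
    simpa using this i (Finset.mem_univ i)
  ext v
  rw [← sum_coord_smul_apply_single]
  exact Finset.sum_eq_zero fun i _ => by
    rw [show fderiv ℝ g x₀ (EuclideanSpace.single i 1) = 0 from hpd i, smul_zero]

theorem eq_of_homogeneous_of_harmonic {g : R3 → ℝ}
    (hg : ∀ x, x ≠ 0 → ContDiffAt ℝ 2 g x)
    (hom : ∀ x, x ≠ 0 → ∀ l : ℝ, 0 < l → g (l • x) = g x)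
    (harm : ∀ x, x ≠ 0 → ∑ i, pd i (pd i g) x = 0) {x y : R3} (hx : x ≠ 0) (hy : y ≠ 0) :
    g x = g y := by
  have hconn : IsPreconnected ({0}ᶜ : Set R3) :=
    (isConnected_compl_singleton_of_one_lt_rank (Module.lt_rank_of_lt_finrank (by simp)) 0).isPreconnected
  exact isOpen_compl_singleton.is_const_of_fderiv_eq_zero (𝕜 := ℝ) hconn
    (fun z hz => ((hg z hz).differentiableAt two_ne_zero).differentiableWithinAt)
    (fun z hz => fderiv_eq_zero_of_homogeneous_of_harmonic hg hom harm hz) hx hy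

end Harmonic

section RadialDecomposition

variable {E : Type*} [NormedAddCommGroup E] [NormedSpace ℝ E]

theorem pd_add {f g : R3 → E} {x : R3} (hf : DifferentiableAt ℝ f x)
    (hg : DifferentiableAt ℝ g x) (i : Fin 3) :
    pd i (fun y => f y + g y) x = pd i f x + pd i g x := by
  simp [pd, fderiv_fun_add hf hg]

theorem pd_smul {c : R3 → ℝ} {f : R3 → E} {x : R3} (hc : DifferentiableAt ℝ c x)
    (hf : DifferentiableAt ℝ f x) (i : Fin 3) :
    pd i (fun y => c y • f y) x = c x • pd i f x + pd i c x • f x := by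
  simp [pd, fderiv_fun_smul hc hf]

theorem differentiableAt_norm_prod {x : R3} (hx : x ≠ 0) :
    DifferentiableAt ℝ (fun y : R3 => (‖y‖, y)) x :=
  ((contDiffAt_norm ℝ hx (n := 1)).differentiableAt one_ne_zero).prodMk differentiableAt_id

theorem pd_comp_norm_prod {K : ℝ × R3 → E} {x : R3} (hx : x ≠ 0)
    (hK : DifferentiableAt ℝ K (‖x‖, x)) (i : Fin 3) :
    pd i (fun y => K (‖y‖, y)) x = pd i (fun y => ‖y‖) x • fderiv ℝ K (‖x‖, x) (1, 0)
      + fderiv ℝ K (‖x‖, x) (0, EuclideanSpace.single i 1) := by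
  have hn : DifferentiableAt ℝ (fun y : R3 => ‖y‖) x :=
    (contDiffAt_norm ℝ hx (n := 1)).differentiableAt one_ne_zero
  have h : HasFDerivAt (fun y => K (‖y‖, y)) _ x :=
    HasFDerivAt.comp (g := K) x hK.hasFDerivAt (hn.hasFDerivAt.prodMk (hasFDerivAt_id x))
  rw [pd, h.fderiv, ← map_smul, ← map_add]
  simp [pd]

theorem pd_comp_norm {k : ℝ → E} {x : R3} (hx : x ≠ 0)
    (hk : DifferentiableAt ℝ k ‖x‖) (i : Fin 3) :
    pd i (fun y => k ‖y‖) x = pd i (fun y => ‖y‖) x • deriv k ‖x‖ := by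
  have hn : DifferentiableAt ℝ (fun y : R3 => ‖y‖) x :=
    (contDiffAt_norm ℝ hx (n := 1)).differentiableAt one_ne_zero
  have h : HasFDerivAt (fun y => k ‖y‖) _ x :=
    HasFDerivAt.comp (g := k) x hk.hasDerivAt.hasFDerivAt hn.hasFDerivAt
  rw [pd, h.fderiv]
  simp [pd]

theorem hasDerivAt_slice {K : ℝ × R3 → E} {ρ : ℝ} {y : R3} (hK : DifferentiableAt ℝ K (ρ, y)) :
    HasDerivAt (fun s => K (s, y)) (fderiv ℝ K (ρ, y) (1, 0)) ρ :=
  hK.hasFDerivAt.comp_hasDerivAt ρ ((hasDerivAt_id ρ).prodMk (hasDerivAt_const ρ y))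

theorem pd_slice {K : ℝ × R3 → E} {ρ : ℝ} {y : R3} (hK : DifferentiableAt ℝ K (ρ, y))
    (i : Fin 3) :
    pd i (fun z => K (ρ, z)) y = fderiv ℝ K (ρ, y) (0, EuclideanSpace.single i 1) := by
  have h : HasFDerivAt (fun z => K (ρ, z)) _ y :=
    HasFDerivAt.comp (g := K) y hK.hasFDerivAt ((hasFDerivAt_const ρ y).prodMk (hasFDerivAt_id y))
  rw [pd, h.fderiv]
  simp

/-- The Laplacian of `x ↦ H(|x|, x)`, for `H` homogeneous of degree zero in its second variable,
is the sum of its radial and its angular part. -/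
theorem sum_pd_pd_comp_norm_prod {S : Set ℝ} (hS : IsOpen S) {H : ℝ × R3 → E}
    (hH : ∀ ρ ∈ S, ∀ y, y ≠ 0 → ContDiffAt ℝ 2 H (ρ, y))
    (hom : ∀ ρ ∈ S, ∀ y, y ≠ 0 → ∀ l : ℝ, 0 < l → H (ρ, l • y) = H (ρ, y))
    {x : R3} (hx : x ≠ 0) (hxS : ‖x‖ ∈ S) :
    ∑ i, pd i (pd i fun y => H (‖y‖, y)) x =
      ∑ i, pd i (pd i fun y => H (‖y‖, x)) x + ∑ i, pd i (pd i fun y => H (‖x‖, y)) x := by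
  let A : ℝ × R3 → E := fun p => fderiv ℝ H p (1, 0)
  let B : Fin 3 → ℝ × R3 → E := fun i p => fderiv ℝ H p (0, EuclideanSpace.single i 1)
  have hHd : ∀ ρ ∈ S, ∀ y, y ≠ 0 → DifferentiableAt ℝ H (ρ, y) := fun ρ hρ y hy =>
    (hH ρ hρ y hy).differentiableAt two_ne_zero
  have hfd : ∀ ρ ∈ S, ∀ y, y ≠ 0 → DifferentiableAt ℝ (fderiv ℝ H) (ρ, y) := fun ρ hρ y hy =>
    ((hH ρ hρ y hy).fderiv_right (m := 1) (by norm_num)).differentiableAt one_ne_zero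
  have hA : ∀ ρ ∈ S, ∀ y, y ≠ 0 → DifferentiableAt ℝ A (ρ, y) := fun ρ hρ y hy =>
    (hfd ρ hρ y hy).clm_apply (differentiableAt_const _)
  have hB : ∀ i, ∀ ρ ∈ S, ∀ y, y ≠ 0 → DifferentiableAt ℝ (B i) (ρ, y) := fun i ρ hρ y hy =>
    (hfd ρ hρ y hy).clm_apply (differentiableAt_const _)
  have hev : ∀ᶠ y in 𝓝 x, ‖y‖ ∈ S ∧ y ≠ 0 :=
    (continuous_norm.continuousAt.eventually (hS.mem_nhds hxS)).and
      (isOpen_compl_singleton.mem_nhds hx)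
  let n : Fin 3 → R3 → ℝ := fun i => pd i fun y => ‖y‖
  have hn : ∀ i, DifferentiableAt ℝ (n i) x := fun i =>
    (contDiffAt_pd (m := 1) (n := 2) (contDiffAt_norm ℝ hx) (by norm_num) i).differentiableAt
      one_ne_zero
  have hU : ∀ i, pd i (pd i fun y => H (‖y‖, y)) x =
      n i x • (n i x • fderiv ℝ A (‖x‖, x) (1, 0)
        + fderiv ℝ A (‖x‖, x) (0, EuclideanSpace.single i 1)) + pd i (n i) x • A (‖x‖, x)
      + (n i x • fderiv ℝ (B i) (‖x‖, x) (1, 0)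
        + fderiv ℝ (B i) (‖x‖, x) (0, EuclideanSpace.single i 1)) := fun i => by
    have h1 : (pd i fun y => H (‖y‖, y)) =ᶠ[𝓝 x]
        fun y => n i y • A (‖y‖, y) + B i (‖y‖, y) := by
      filter_upwards [hev] with y hy
      exact pd_comp_norm_prod hy.2 (hHd _ hy.1 _ hy.2) i
    have hAx := hA _ hxS _ hx
    have hBx := hB i _ hxS _ hx
    have hA' : DifferentiableAt ℝ (fun y => A (‖y‖, y)) x :=
      DifferentiableAt.comp (g := A) x hAx (differentiableAt_norm_prod hx)
    have hB' : DifferentiableAt ℝ (fun y => B i (‖y‖, y)) x :=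
      DifferentiableAt.comp (g := B i) x hBx (differentiableAt_norm_prod hx)
    rw [(eventuallyEq_pd h1 i).eq_of_nhds, pd_add ((hn i).fun_smul hA') hB', pd_smul (hn i) hA',
      pd_comp_norm_prod hx hAx, pd_comp_norm_prod hx hBx]
  have hR : ∀ i, pd i (pd i fun y => H (‖y‖, x)) x =
      n i x • n i x • fderiv ℝ A (‖x‖, x) (1, 0) + pd i (n i) x • A (‖x‖, x) := fun i => by
    have h1 : (pd i fun y => H (‖y‖, x)) =ᶠ[𝓝 x] fun y => n i y • A (‖y‖, x) := by
      filter_upwards [hev] with y hy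
      have hd := hasDerivAt_slice (hHd _ hy.1 _ hx)
      rw [pd_comp_norm (k := fun s => H (s, x)) hy.2 hd.differentiableAt, hd.deriv]
    have hd := hasDerivAt_slice (hA _ hxS _ hx)
    have hA' : DifferentiableAt ℝ (fun y : R3 => A (‖y‖, x)) x :=
      DifferentiableAt.comp (g := fun s => A (s, x)) x hd.differentiableAt
        ((contDiffAt_norm ℝ hx (n := 1)).differentiableAt one_ne_zero)
    rw [(eventuallyEq_pd h1 i).eq_of_nhds, pd_smul (hn i) hA',
      pd_comp_norm (k := fun s => A (s, x)) hx hd.differentiableAt, hd.deriv]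
  have hG : ∀ i, pd i (pd i fun y => H (‖x‖, y)) x =
      fderiv ℝ (B i) (‖x‖, x) (0, EuclideanSpace.single i 1) := fun i => by
    have h1 : (pd i fun y => H (‖x‖, y)) =ᶠ[𝓝 x] fun y => B i (‖x‖, y) := by
      filter_upwards [hev] with y hy
      exact pd_slice (hHd _ hxS _ hy.2) i
    rw [(eventuallyEq_pd h1 i).eq_of_nhds, pd_slice (hB i _ hxS _ hx)]
  have hslice : ∀ {K : ℝ × R3 → E} {ρ : ℝ}, DifferentiableAt ℝ K (ρ, x) →
      DifferentiableAt ℝ (fun z => K (ρ, z)) x := fun {K ρ} hK =>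
    DifferentiableAt.comp (g := K) x hK ((differentiableAt_const ρ).prodMk differentiableAt_id)
  have hEA : ∑ i, x i • fderiv ℝ A (‖x‖, x) (0, EuclideanSpace.single i 1) = 0 := by
    have hAx := hA _ hxS _ hx
    simp only [← pd_slice hAx, pd]
    rw [sum_coord_smul_apply_single]
    refine fderiv_apply_self_eq_zero (hslice hAx) fun l hl => ?_
    have hlx : l • x ≠ 0 := smul_ne_zero hl.ne' hx
    refine (hasDerivAt_slice (hHd _ hxS _ hlx)).unique
      ((hasDerivAt_slice (hHd _ hxS _ hx)).congr_of_eventuallyEq ?_)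
    filter_upwards [hS.mem_nhds hxS] with s hs using hom s hs x hx l hl
  have hEB : ∑ i, x i • fderiv ℝ (B i) (‖x‖, x) (1, 0) = 0 := by
    have h1 : HasDerivAt (fun s => ∑ i, x i • B i (s, x))
        (∑ i, x i • fderiv ℝ (B i) (‖x‖, x) (1, 0)) ‖x‖ :=
      HasDerivAt.fun_sum fun i _ => (hasDerivAt_slice (hB i _ hxS _ hx)).const_smul (x i)
    refine h1.unique ((hasDerivAt_const ‖x‖ (0 : E)).congr_of_eventuallyEq ?_)
    filter_upwards [hS.mem_nhds hxS] with s hs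
    have hHx := hHd s hs x hx
    simp only [B, ← pd_slice hHx, pd]
    rw [sum_coord_smul_apply_single]
    exact fderiv_apply_self_eq_zero (hslice hHx) (hom s hs x hx)
  have hcross : ∑ i, n i x • (fderiv ℝ A (‖x‖, x) (0, EuclideanSpace.single i 1)
      + fderiv ℝ (B i) (‖x‖, x) (1, 0)) = 0 := by
    simp only [n, pd_norm hx, mul_smul, ← Finset.smul_sum, smul_add, Finset.sum_add_distrib, hEA,
      hEB, add_zero, smul_zero]
  simp only [hU, hR, hG]
  rw [← Finset.sum_add_distrib, ← sub_eq_zero, ← Finset.sum_sub_distrib, ← hcross]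
  refine Finset.sum_congr rfl fun i _ => ?_
  simp only [smul_add]
  abel

/-- Dilation invariance reduces harmonicity to a single sphere. -/
theorem sum_pd_pd_smul_of_homogeneous {g : R3 → E} (hom : ∀ l : ℝ, 0 < l → ∀ x, x ≠ 0 →
    g (l • x) = g x) {x : R3} (hx : x ≠ 0) {l : ℝ} (hl : 0 < l) :
    ∑ i, pd i (pd i g) x = l ^ 2 • ∑ i, pd i (pd i g) (l • x) := by
  have hpd : ∀ (f : R3 → E) (i : Fin 3) (y : R3),
      pd i (fun z => f (l • z)) y = l • pd i f (l • y) := fun f i y => by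
    simp only [pd]
    rw [fderiv_comp_smul]
    simp
  have hne : {0}ᶜ ∈ 𝓝 x := isOpen_compl_singleton.mem_nhds hx
  have h1 : g =ᶠ[𝓝 x] fun z => g (l • z) := by
    filter_upwards [hne] with z hz using (hom l hl z hz).symm
  rw [Finset.smul_sum]
  refine Finset.sum_congr rfl fun i _ => ?_
  rw [(eventuallyEq_pd (eventuallyEq_pd h1 i) i).eq_of_nhds]
  have h2 : (pd i fun z => g (l • z)) = fun y => l • pd i g (l • y) := funext (hpd g i)
  rw [h2]
  have h3 := hpd (fun y => l • pd i g y) i x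
  rw [h3]
  have h4 : pd i (fun y => l • pd i g y) (l • x) = l • pd i (pd i g) (l • x) := by
    change fderiv ℝ (l • pd i g) (l • x) _ = _
    rw [fderiv_const_smul_field]
    rfl
  rw [h4, pow_two, mul_smul]

end RadialDecomposition

theorem eq_of_homogeneous_of_harmonic_complex {g : R3 → ℂ}
    (hg : ∀ x, x ≠ 0 → ContDiffAt ℝ 2 g x)
    (hom : ∀ x, x ≠ 0 → ∀ l : ℝ, 0 < l → g (l • x) = g x)
    (harm : ∀ x, x ≠ 0 → ∑ i, pd i (pd i g) x = 0) {x y : R3} (hx : x ≠ 0) (hy : y ≠ 0) :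
    g x = g y := by
  have key : ∀ L : ℂ →L[ℝ] ℝ, L (g x) = L (g y) := fun L => by
    refine eq_of_homogeneous_of_harmonic (g := fun z => L (g z))
      (fun z hz => L.contDiff.contDiffAt.comp z (hg z hz))
      (fun z hz l hl => by rw [hom z hz l hl]) (fun z hz => ?_) hx hy
    have h1 : ∀ i, pd i (pd i fun y => L (g y)) z = L (pd i (pd i g) z) := fun i => by
      have h2 : (pd i fun y => L (g y)) =ᶠ[𝓝 z] fun y => L (pd i g y) := by
        filter_upwards [isOpen_compl_singleton.mem_nhds hz] with v hv
        exact pd_continuousLinearMap_comp L ((hg v hv).differentiableAt two_ne_zero) i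
      rw [(eventuallyEq_pd h2 i).eq_of_nhds, pd_continuousLinearMap_comp L
        ((contDiffAt_pd (m := 1) (hg z hz) (by norm_num) i).differentiableAt one_ne_zero)]
    simp only [h1]
    rw [← map_sum, harm z hz, map_zero]
  exact Complex.ext (key Complex.reCLM) (key Complex.imCLM)

theorem pd_eventuallyEq_zero {E : Type*} [NormedAddCommGroup E] [NormedSpace ℝ E]
    {f : R3 → E} {x : R3} {c : E} (h : f =ᶠ[𝓝 x] fun _ => c) (i : Fin 3) :
    pd i f =ᶠ[𝓝 x] fun _ => 0 :=
  (eventuallyEq_pd h i).trans (.of_eq (by ext; simp [pd]))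

theorem exists_eq_add_smul_of_deriv_deriv_eq_zero {E : Type*} [NormedAddCommGroup E]
    [NormedSpace ℝ E] {I : Set ℝ} (hI : IsOpen I) (hIc : IsPreconnected I) {f : ℝ → E}
    (hf : ContDiffOn ℝ 2 f I) (h : ∀ t ∈ I, deriv (deriv f) t = 0) :
    ∃ c₁ c₂ : E, ∀ t ∈ I, f t = c₁ + t • c₂ := by
  have hd : DifferentiableOn ℝ f I := hf.differentiableOn two_ne_zero
  have hd' : DifferentiableOn ℝ (deriv f) I :=
    (hf.deriv_of_isOpen (m := 1) hI (by norm_num)).differentiableOn one_ne_zero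
  obtain ⟨c₂, hc₂⟩ := hI.exists_is_const_of_deriv_eq_zero hIc hd' h
  have hder : ∀ t ∈ I, HasDerivAt (fun s => f s - s • c₂) 0 t := fun t ht => by
    have h1 := (hd.differentiableAt (hI.mem_nhds ht)).hasDerivAt.fun_sub
      ((hasDerivAt_id t).smul_const c₂)
    simpa [hc₂ t ht] using h1
  obtain ⟨c₁, hc₁⟩ := hI.exists_is_const_of_deriv_eq_zero hIc
    (fun t ht => (hder t ht).differentiableAt.differentiableWithinAt)
    (fun t ht => (hder t ht).deriv)
  exact ⟨c₁, c₂, fun t ht => by rw [← hc₁ t ht]; abel⟩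

/-- If a profile solves the wave equation both as modulated spherical wave and with frozen angular
variable, then its angular Laplacian vanishes. -/
theorem sum_pd_pd_angular_eq_zero {a b t : ℝ} (ha : 0 < a) {v : ℝ → ℝ → R3 → ℂ}
    (hsm : ∀ ρ ∈ Set.Ioo a b, ∀ y, y ≠ 0 →
      ContDiffAt ℝ 2 (fun p : ℝ × R3 => v t p.1 p.2) (ρ, y))
    (hhom : ∀ r ∈ Set.Ioo a b, ∀ x : R3, x ≠ 0 → ∀ l : ℝ, 0 < l → v t r (l • x) = v t r x)
    {x : R3} (hx : ‖x‖ ∈ Set.Ioo a b)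
    (hrad : waveOp (fun s y => v s ‖y‖ (‖x‖⁻¹ • x)) t x = 0)
    (hwave : waveOp (fun s y => v s ‖y‖ (‖y‖⁻¹ • y)) t x = 0) :
    ∑ i, pd i (pd i fun y => v t ‖x‖ y) x = 0 := by
  have hx0 : x ≠ 0 := norm_pos_iff.1 (ha.trans hx.1)
  have h := sum_pd_pd_comp_norm_prod isOpen_Ioo (H := fun p : ℝ × R3 => v t p.1 p.2) hsm hhom hx0 hx
  have hev : ∀ᶠ y in 𝓝 x, ‖y‖ ∈ Set.Ioo a b :=
    continuous_norm.continuousAt.eventually (isOpen_Ioo.mem_nhds hx)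
  have hU : (fun y => v t ‖y‖ y) =ᶠ[𝓝 x] fun y => v t ‖y‖ (‖y‖⁻¹ • y) := by
    filter_upwards [hev] with y hy
    have hy0 : 0 < ‖y‖ := ha.trans hy.1
    exact (hhom _ hy _ (norm_pos_iff.1 hy0) _ (inv_pos.2 hy0)).symm
  have hR : (fun y => v t ‖y‖ x) =ᶠ[𝓝 x] fun y => v t ‖y‖ (‖x‖⁻¹ • x) := by
    filter_upwards [hev] with y hy
    exact (hhom _ hy _ hx0 _ (inv_pos.2 (norm_pos_iff.2 hx0))).symm
  simp only [fun i => (eventuallyEq_pd (eventuallyEq_pd hU i) i).eq_of_nhds,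
    fun i => (eventuallyEq_pd (eventuallyEq_pd hR i) i).eq_of_nhds] at h
  simp only [waveOp, Fin.sum_univ_three] at *
  linear_combination hrad - hwave - h

/-- **Theorem 2.2 (no modulated spherical Maxwell solutions).**
Let `w(t,r,ω)` be a smooth `ℂ⁶`-valued modulated spherical profile each of whose components
satisfies, for each fixed `ω ∈ S²`, the wave equation as a function of `(t,x)` on
`{t ∈ I, a < |x| < b}`.  Then `u(t,x) := w(t,|x|,x/|x|) = (E,B)` satisfies `□u = 0`
and `div E = div B = 0` there if and only if `u = c₁ + c₂ t` for constant
vectors `c₁, c₂ ∈ ℂ⁶`. -/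
theorem no_modulated_spherical_maxwell
    (I : Set ℝ) (hIopen : IsOpen I) (hIne : I.Nonempty) (hIconn : I.OrdConnected)
    (a b : ℝ) (ha : 0 < a) (hab : a < b)
    (w : ℝ → ℝ → R3 → Fin 6 → ℂ)
    (hsm : ∀ n : ℕ, ContDiffOn ℝ n (fun p : ℝ × ℝ × R3 => w p.1 p.2.1 p.2.2)
      (I ×ˢ (Set.Ioo a b) ×ˢ {x : R3 | x ≠ 0}))
    (hhom : ∀ t ∈ I, ∀ r ∈ Set.Ioo a b, ∀ x : R3, x ≠ 0 → ∀ l : ℝ, 0 < l →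
      w t r (l • x) = w t r x)
    (hwave : ∀ ω : R3, ‖ω‖ = 1 → ∀ j : Fin 6, ∀ t ∈ I, ∀ x : R3, a < ‖x‖ → ‖x‖ < b →
      waveOp (fun s y => w s ‖y‖ ω j) t x = 0) :
    ((∀ j : Fin 6, ∀ t ∈ I, ∀ x : R3, a < ‖x‖ → ‖x‖ < b →
        waveOp (fun s y => w s ‖y‖ (‖y‖⁻¹ • y) j) t x = 0) ∧
     (∀ t ∈ I, ∀ x : R3, a < ‖x‖ → ‖x‖ < b →
        (pd 0 (fun y => w t ‖y‖ (‖y‖⁻¹ • y) 0) x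
          + pd 1 (fun y => w t ‖y‖ (‖y‖⁻¹ • y) 1) x
          + pd 2 (fun y => w t ‖y‖ (‖y‖⁻¹ • y) 2) x = 0) ∧
        (pd 0 (fun y => w t ‖y‖ (‖y‖⁻¹ • y) 3) x
          + pd 1 (fun y => w t ‖y‖ (‖y‖⁻¹ • y) 4) x
          + pd 2 (fun y => w t ‖y‖ (‖y‖⁻¹ • y) 5) x = 0)))
    ↔ (∃ c₁ c₂ : Fin 6 → ℂ, ∀ t ∈ I, ∀ x : R3, a < ‖x‖ → ‖x‖ < b →
        w t ‖x‖ (‖x‖⁻¹ • x) = c₁ + (t : ℂ) • c₂) := by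
  have hpre : IsPreconnected I := hIconn.isPreconnected
  have he1 : ‖e1‖ = 1 := by simp [e1]
  have he10 : e1 ≠ 0 := norm_pos_iff.1 (by simp [he1])
  have hopen : IsOpen (I ×ˢ (Set.Ioo a b) ×ˢ {x : R3 | x ≠ 0}) :=
    hIopen.prod (isOpen_Ioo.prod isOpen_ne)
  have hsm2 : ∀ j, ∀ t ∈ I, ∀ r ∈ Set.Ioo a b, ∀ y : R3, y ≠ 0 →
      ContDiffAt ℝ 2 (fun p : ℝ × ℝ × R3 => w p.1 p.2.1 p.2.2 j) (t, r, y) :=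
    fun j t ht r hr y hy => contDiffAt_pi.1 ((hsm 2).contDiffAt
      (hopen.mem_nhds (show (t, r, y) ∈ _ from ⟨ht, hr, hy⟩))) j
  have hsmt : ∀ j, ∀ t ∈ I, ∀ r ∈ Set.Ioo a b, ∀ y : R3, y ≠ 0 →
      ContDiffAt ℝ 2 (fun p : ℝ × R3 => w t p.1 p.2 j) (r, y) := fun j t ht r hr y hy =>
    ContDiffAt.comp (g := fun p : ℝ × ℝ × R3 => w p.1 p.2.1 p.2.2 j) (r, y) (hsm2 j t ht r hr y hy)
      (contDiffAt_const.prodMk contDiffAt_id)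
  have hnear : ∀ x : R3, ‖x‖ ∈ Set.Ioo a b → ∀ᶠ y in 𝓝 x, ‖y‖ ∈ Set.Ioo a b := fun x hx =>
    continuous_norm.continuousAt.eventually (isOpen_Ioo.mem_nhds hx)
  constructor
  · rintro ⟨hbox, hdiv⟩
    have hang : ∀ j, ∀ t ∈ I, ∀ r ∈ Set.Ioo a b, ∀ x : R3, x ≠ 0 → w t r x j = w t r e1 j := by
      intro j t ht r hr x hx
      have hr0 : 0 < r := ha.trans hr.1
      have hom : ∀ l : ℝ, 0 < l → ∀ z : R3, z ≠ 0 → w t r (l • z) j = w t r z j :=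
        fun l hl z hz => by rw [hhom t ht r hr z hz l hl]
      refine eq_of_homogeneous_of_harmonic_complex (g := fun z => w t r z j)
        (fun z hz => ContDiffAt.comp (g := fun p : ℝ × R3 => w t p.1 p.2 j) z
          (hsmt j t ht r hr z hz) (contDiffAt_const.prodMk contDiffAt_id))
        (fun z hz l hl => hom l hl z hz) (fun z hz => ?_) hx he10
      have hz0 : 0 < ‖z‖ := norm_pos_iff.2 hz
      have hl : 0 < r / ‖z‖ := by positivity
      rw [sum_pd_pd_smul_of_homogeneous (g := fun z => w t r z j) hom hz hl]
      have hn : ‖(r / ‖z‖) • z‖ = r := by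
        rw [norm_smul, Real.norm_of_nonneg hl.le]
        field_simp
      generalize (r / ‖z‖) • z = y at hn
      subst hn
      have hω : ‖‖y‖⁻¹ • y‖ = 1 := by
        rw [norm_smul, norm_inv, norm_norm, inv_mul_cancel₀ hr0.ne']
      rw [sum_pd_pd_angular_eq_zero ha (v := fun t r x => w t r x j) (hsmt j t ht)
        (fun r hr x hx l hl => by rw [hhom t ht r hr x hx l hl]) hr
        (hwave _ hω j t ht y hr.1 hr.2) (hbox j t ht y hr.1 hr.2), smul_zero]
    have hrd : ∀ j, ∀ t ∈ I, ∀ r ∈ Set.Ioo a b,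
        DifferentiableAt ℝ (fun ρ => w t ρ e1 j) r := fun j t ht r hr =>
      (hasDerivAt_slice (K := fun p : ℝ × R3 => w t p.1 p.2 j)
        ((hsmt j t ht r hr e1 he10).differentiableAt two_ne_zero)).differentiableAt
    have hpd : ∀ (j : Fin 6) (m : Fin 3), ∀ t ∈ I, ∀ x : R3, ‖x‖ ∈ Set.Ioo a b →
        pd m (fun y => w t ‖y‖ (‖y‖⁻¹ • y) j) x =
          (‖x‖⁻¹ * x m) • deriv (fun ρ => w t ρ e1 j) ‖x‖ := by
      intro j m t ht x hx
      have hx0 : x ≠ 0 := norm_pos_iff.1 (ha.trans hx.1)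
      have h1 : (fun y => w t ‖y‖ (‖y‖⁻¹ • y) j) =ᶠ[𝓝 x] fun y => w t ‖y‖ e1 j := by
        filter_upwards [hnear x hx] with y hy
        have hy0 : 0 < ‖y‖ := ha.trans hy.1
        exact hang j t ht _ hy _ (smul_ne_zero (inv_pos.2 hy0).ne' (norm_pos_iff.1 hy0))
      rw [(eventuallyEq_pd h1 m).eq_of_nhds, pd_comp_norm (k := fun ρ => w t ρ e1 j) hx0
        (hrd j t ht _ hx), pd_norm hx0]
    have hdr : ∀ j, ∀ t ∈ I, ∀ r ∈ Set.Ioo a b, deriv (fun ρ => w t ρ e1 j) r = 0 := by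
      intro j t ht r hr
      have hr0 : 0 < r := ha.trans hr.1
      have hn : ∀ i : Fin 3, ‖r • (EuclideanSpace.single i 1 : R3)‖ = r := fun i => by
        simp [norm_smul, hr0.le]
      have hd : ∀ i : Fin 3, _ := fun i => hdiv t ht (r • EuclideanSpace.single i 1)
        (by rw [hn i]; exact hr.1) (by rw [hn i]; exact hr.2)
      have hp := fun (j : Fin 6) (i m : Fin 3) => hpd j m t ht (r • EuclideanSpace.single i 1)
        (by rw [hn i]; exact hr)
      simp only [hp, hn] at hd
      fin_cases j
      · simpa [hr0.ne'] using (hd 0).1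
      · simpa [hr0.ne'] using (hd 1).1
      · simpa [hr0.ne'] using (hd 2).1
      · simpa [hr0.ne'] using (hd 0).2
      · simpa [hr0.ne'] using (hd 1).2
      · simpa [hr0.ne'] using (hd 2).2
    obtain ⟨r₀, hr₀⟩ : (Set.Ioo a b).Nonempty := nonempty_Ioo.2 hab
    have hr₀pos : 0 < r₀ := ha.trans hr₀.1
    have hconst : ∀ j, ∀ t ∈ I, ∀ r ∈ Set.Ioo a b, w t r e1 j = w t r₀ e1 j :=
      fun j t ht r hr => isOpen_Ioo.is_const_of_deriv_eq_zero isPreconnected_Ioo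
        (fun s hs => (hrd j t ht s hs).differentiableWithinAt) (hdr j t ht) hr hr₀
    have htime : ∀ j, ∃ c₁ c₂ : ℂ, ∀ t ∈ I, w t r₀ e1 j = c₁ + t • c₂ := fun j => by
      refine exists_eq_add_smul_of_deriv_deriv_eq_zero hIopen hpre
        (fun t ht => (ContDiffAt.comp (g := fun p : ℝ × ℝ × R3 => w p.1 p.2.1 p.2.2 j) t
          (hsm2 j t ht r₀ hr₀ e1 he10)
          (contDiffAt_id.prodMk contDiffAt_const)).contDiffWithinAt) fun t ht => ?_
      have hn : ‖r₀ • e1‖ = r₀ := by simp [norm_smul, he1, hr₀pos.le]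
      have hc : (fun y => w t ‖y‖ e1 j) =ᶠ[𝓝 (r₀ • e1)] fun _ => w t r₀ e1 j := by
        filter_upwards [hnear (r₀ • e1) (by rwa [hn])] with y hy using hconst j t ht _ hy
      have h := hwave e1 he1 j t ht (r₀ • e1) (by rw [hn]; exact hr₀.1) (by rw [hn]; exact hr₀.2)
      simp only [waveOp, fun i => (pd_eventuallyEq_zero (pd_eventuallyEq_zero hc i) i).eq_of_nhds,
        hn] at h
      simpa using h
    choose c₁ c₂ hc using htime
    refine ⟨c₁, c₂, fun t ht x hxa hxb => ?_⟩
    have hx0 : 0 < ‖x‖ := ha.trans hxa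
    funext j
    rw [hang j t ht _ ⟨hxa, hxb⟩ _ (smul_ne_zero (inv_pos.2 hx0).ne' (norm_pos_iff.1 hx0)),
      hconst j t ht _ ⟨hxa, hxb⟩, hc j t ht]
    simp
  · rintro ⟨c₁, c₂, hc⟩
    have hspace : ∀ j, ∀ t ∈ I, ∀ x : R3, a < ‖x‖ → ‖x‖ < b →
        (fun y => w t ‖y‖ (‖y‖⁻¹ • y) j) =ᶠ[𝓝 x] fun _ => c₁ j + t * c₂ j := by
      intro j t ht x hxa hxb
      filter_upwards [hnear x ⟨hxa, hxb⟩] with y hy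
      simp [hc t ht y hy.1 hy.2]
    refine ⟨fun j t ht x hxa hxb => ?_, fun t ht x hxa hxb => ?_⟩
    · have htime : (fun s => w s ‖x‖ (‖x‖⁻¹ • x) j) =ᶠ[𝓝 t] fun s => c₁ j + s * c₂ j := by
        filter_upwards [hIopen.mem_nhds ht] with s hs
        simp [hc s hs x hxa hxb]
      have hder : deriv (fun s : ℝ => c₁ j + s * c₂ j) = fun _ => c₂ j := by
        funext s
        simpa using (((hasDerivAt_id s).ofReal_comp.mul_const (c₂ j)).const_add (c₁ j)).deriv
      simp only [waveOp, fun i => (pd_eventuallyEq_zero (pd_eventuallyEq_zero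
        (hspace j t ht x hxa hxb) i) i).eq_of_nhds]
      have h2 := htime.deriv.deriv_eq
      rw [hder] at h2
      rw [h2]
      simp
    · simp only [fun j i => (pd_eventuallyEq_zero (hspace j t ht x hxa hxb) i).eq_of_nhds]
      simp
end
end

section
/- Let f : ℝ → ℝ be twice continuously differentiable and t ∈ ℝ. Define on ℝ³ \ {0}, writing s = |x|+t, n = x/|x|, e₁ = (1,0,0), the vector field E(x) = (f'(s)/|x| − f(s)/|x|²) (n × e₁). Then for all x ≠ 0, curl E(x) = (f''(s)/|x| − 3 f'(s)/|x|² + 3 f(s)/|x|³) (n × (n × e₁)) − 2 (f'(s)/|x|² − f(s)/|x|³) e₁. -/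
noncomputable section

open Real Set MeasureTheory

theorem hasFDerivAt_norm_of_ne_zero {E : Type*} [NormedAddCommGroup E] [InnerProductSpace ℝ E]
    {x : E} (hx : x ≠ 0) :
    HasFDerivAt (fun y : E => ‖y‖) (‖x‖⁻¹ • innerSL ℝ x) x := by
  have h := (hasStrictFDerivAt_norm_sq x).hasFDerivAt.sqrt (by positivity)
  simp only [Real.sqrt_sq (norm_nonneg _)] at h
  refine h.congr_fderiv ?_
  ext v
  simp
  field_simp

/-- The partial derivatives of a radial function times a coordinate. -/
theorem pd_radial_mul_coord {g : ℝ → ℝ} {g' : ℝ} {x : R3} (hx : x ≠ 0)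
    (hg : HasDerivAt g g' ‖x‖) (i j : Fin 3) :
    pd i (fun y : R3 => g ‖y‖ * y j) x =
      g' * (x i / ‖x‖) * x j + g ‖x‖ * (if j = i then 1 else 0) := by
  have h₁ : HasFDerivAt (fun y : R3 => g ‖y‖) (g' • ‖x‖⁻¹ • innerSL ℝ x) x :=
    hg.comp_hasFDerivAt x (hasFDerivAt_norm_of_ne_zero hx)
  have h₂ : HasFDerivAt (fun y : R3 => y j) (EuclideanSpace.proj j : R3 →L[ℝ] ℝ) x :=
    (EuclideanSpace.proj j : R3 →L[ℝ] ℝ).hasFDerivAt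
  rw [pd, (h₁.fun_mul h₂).fderiv]
  simp [EuclideanSpace.inner_single_right]
  ring

theorem hasDerivAt_radial_profile {f : ℝ → ℝ} (hf : ContDiff ℝ 2 f) (t : ℝ) {r : ℝ} (hr : r ≠ 0) :
    HasDerivAt (fun r => deriv f (r + t) / r ^ 2 - f (r + t) / r ^ 3)
      (deriv (deriv f) (r + t) / r ^ 2 - 3 * deriv f (r + t) / r ^ 3 + 3 * f (r + t) / r ^ 4)
      r := by
  have hf' : ContDiff ℝ 1 (deriv f) := hf.deriv'
  have h₀ := ((hf.differentiable (by norm_num) (r + t)).hasDerivAt).comp_add_const r t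
  have h₁ := ((hf'.differentiable (by norm_num) (r + t)).hasDerivAt).comp_add_const r t
  refine ((h₁.fun_div (hasDerivAt_pow 2 r) (by positivity)).fun_sub
    (h₀.fun_div (hasDerivAt_pow 3 r) (by positivity))).congr_deriv ?_
  field_simp
  push_cast
  ring

/-- Equation (3.17): the curl of
`E(x) = (f'(s)/|x| − f(s)/|x|²)(n × e₁)`, `s = |x|+t`, `n = x/|x|`, is
`curl E = (f''(s)/|x| − 3f'(s)/|x|² + 3f(s)/|x|³)(n × (n × e₁)) − 2(f'(s)/|x|² − f(s)/|x|³) e₁`. -/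
theorem curl_incoming_E (f : ℝ → ℝ) (hf : ContDiff ℝ 2 f) (t : ℝ)
    (x : R3) (hx : x ≠ 0) :
    curl3 (fun y =>
        (deriv f (‖y‖ + t) / ‖y‖ - f (‖y‖ + t) / ‖y‖ ^ 2) •
          cross3 (‖y‖⁻¹ • y) e1) x =
      (deriv (deriv f) (‖x‖ + t) / ‖x‖ - 3 * deriv f (‖x‖ + t) / ‖x‖ ^ 2
          + 3 * f (‖x‖ + t) / ‖x‖ ^ 3) •
        cross3 (‖x‖⁻¹ • x) (cross3 (‖x‖⁻¹ • x) e1)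
      - (2 * (deriv f (‖x‖ + t) / ‖x‖ ^ 2 - f (‖x‖ + t) / ‖x‖ ^ 3)) • e1 := by
  have hr : ‖x‖ ≠ 0 := norm_ne_zero_iff.mpr hx
  let g : ℝ → ℝ := fun r => deriv f (r + t) / r ^ 2 - f (r + t) / r ^ 3
  have hE : (fun y : R3 => (deriv f (‖y‖ + t) / ‖y‖ - f (‖y‖ + t) / ‖y‖ ^ 2) •
        cross3 (‖y‖⁻¹ • y) e1) =
      fun y => (WithLp.equiv 2 (Fin 3 → ℝ)).symm ![0, g ‖y‖ * y 2, -(g ‖y‖ * y 1)] := by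
    funext y
    ext i
    fin_cases i <;> simp [cross3, e1, g] <;> ring
  have hpd := pd_radial_mul_coord hx (hasDerivAt_radial_profile hf t hr)
  have hneg (i : Fin 3) : pd i (fun y : R3 => -(g ‖y‖ * y 1)) x =
      -pd i (fun y : R3 => g ‖y‖ * y 1) x := by
    simp [pd, fderiv_fun_neg]
  have hzero (i : Fin 3) : pd i (fun _ : R3 => (0 : ℝ)) x = 0 := by
    simp [pd]
  rw [hE]
  ext i
  fin_cases i <;>
    simp [curl3, hneg, hzero, g, hpd, cross3, e1]
  all_goals field_simp
  all_goals ring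
end
end
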